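/- arXiv:1511.03716 — 2 statements merged into one kernel-verified Lean document; each statement's English description precedes it below -/
import Mathlib

section
/- For every complex number q with |q| < 1, the Borwein theta function satisfies a₀(q) = ∑_{m,n ∈ ℤ} q^{m²+mn+n²} = 1 + 6 ∑_{n=0}^∞ q^{3n+1}/(1-q^{3n+1}) - 6 ∑_{n=0}^∞ q^{3n+2}/(1-q^{3n+2}). -/
/-- Borwein theta function `a₀(q) = ∑_{m,n ∈ ℤ} q^{m²+mn+n²}`. -/
noncomputable def a0 (q : ℂ) : ℂ :=
  ∑' p : ℤ × ℤ, q ^ (p.1 ^ 2 + p.1 * p.2 + p.2 ^ 2)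

def bQ (x : ℤ × ℤ) : ℤ := x.1 ^ 2 + x.1 * x.2 + x.2 ^ 2
def bm (x y : ℤ × ℤ) : ℤ × ℤ := (x.1 * y.1 - x.2 * y.2, x.1 * y.2 + x.2 * y.1 + x.2 * y.2)
noncomputable def bS (n : ℕ) : Finset (ℤ × ℤ) :=
  (Finset.Icc (-(n : ℤ)) n ×ˢ Finset.Icc (-(n : ℤ)) n).filter (fun x => bQ x = n)
def bchi (n : ℕ) : ℤ := if n % 3 = 1 then 1 else if n % 3 = 2 then -1 else 0
def bs (n : ℕ) : ℤ := ∑ d ∈ n.divisors, bchi d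
noncomputable def br (n : ℕ) : ℤ := (bS n).card

lemma bQ_bm (x y : ℤ × ℤ) : bQ (bm x y) = bQ x * bQ y := by
  simp only [bQ, bm]; ring

lemma mem_bS (n : ℕ) (x : ℤ × ℤ) : x ∈ bS n ↔ bQ x = n := by
  obtain ⟨a, b⟩ := x
  rw [bS, Finset.mem_filter, Finset.mem_product, Finset.mem_Icc, Finset.mem_Icc]
  simp only [bQ, and_iff_right_iff_imp]
  intro h
  have hn : (0 : ℤ) ≤ n := by positivity
  refine ⟨⟨?_, ?_⟩, ?_, ?_⟩ <;> by_contra hc <;> push Not at hc <;>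
    nlinarith [sq_nonneg (2 * a + b), sq_nonneg (2 * b + a)]

lemma br_one : br 1 = 6 := by decide

lemma bchi_mul (a b : ℕ) : bchi (a * b) = bchi a * bchi b := by
  unfold bchi
  rw [Nat.mul_mod]
  have ha : a % 3 < 3 := Nat.mod_lt _ (by norm_num)
  have hb : b % 3 < 3 := Nat.mod_lt _ (by norm_num)
  generalize a % 3 = u at *
  generalize b % 3 = v at *
  interval_cases u <;> interval_cases v <;> simp

/-- Hecke relation on the divisor side. -/
lemma bs_hecke (p n : ℕ) (hp : p.Prime) (hn : 0 < n) :
    bs (p * n) + bchi p * (if p ∣ n then bs (n / p) else 0) = (1 + bchi p) * bs n := by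
  have hinj : Function.Injective (fun d : ℕ => p * d) := fun a b h =>
    Nat.eq_of_mul_eq_mul_left hp.pos h
  have hU : (p * n).divisors = n.divisors ∪ n.divisors.image (fun d => p * d) := by
    ext d
    simp only [Nat.mem_divisors, Finset.mem_union, Finset.mem_image]
    constructor
    · rintro ⟨h, -⟩
      by_cases hd : p ∣ d
      · right
        obtain ⟨e, rfl⟩ := hd
        exact ⟨e, ⟨Nat.dvd_of_mul_dvd_mul_left hp.pos h, hn.ne'⟩, rfl⟩
      · left
        refine ⟨?_, hn.ne'⟩
        exact (Nat.Coprime.dvd_of_dvd_mul_left ((Nat.Prime.coprime_iff_not_dvd hp).2 hd).symm h)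
    · rintro (⟨h, -⟩ | ⟨e, ⟨h, -⟩, rfl⟩)
      · exact ⟨h.mul_left p, by positivity [hp.pos]⟩
      · exact ⟨Nat.mul_dvd_mul_left p h, by positivity [hp.pos]⟩
  have hI : ∑ d ∈ n.divisors ∩ n.divisors.image (fun d => p * d), bchi d
      = bchi p * (if p ∣ n then bs (n / p) else 0) := by
    split_ifs with h
    · obtain ⟨k, rfl⟩ := h
      have : (p * k).divisors ∩ (p * k).divisors.image (fun d => p * d)
          = k.divisors.image (fun d => p * d) := by
        ext d
        simp only [Nat.mem_divisors, Finset.mem_inter, Finset.mem_image]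
        have hk : k ≠ 0 := by rintro rfl; simp at hn
        constructor
        · rintro ⟨⟨h1, h2⟩, e, ⟨h3, -⟩, rfl⟩
          exact ⟨e, ⟨Nat.dvd_of_mul_dvd_mul_left hp.pos h1, hk⟩, rfl⟩
        · rintro ⟨e, ⟨h3, -⟩, rfl⟩
          exact ⟨⟨Nat.mul_dvd_mul_left p h3, hn.ne'⟩, e, ⟨h3.mul_left p, hn.ne'⟩, rfl⟩
      rw [this, Finset.sum_image (fun a _ b _ h => hinj h), Nat.mul_div_cancel_left _ hp.pos, bs,
        Finset.mul_sum]
      exact Finset.sum_congr rfl fun d _ => bchi_mul p d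
    · have : n.divisors ∩ n.divisors.image (fun d => p * d) = ∅ := by
        ext d
        simp only [Nat.mem_divisors, Finset.mem_inter, Finset.mem_image, Finset.notMem_empty,
          iff_false]
        rintro ⟨⟨h1, h2⟩, e, ⟨h3, -⟩, rfl⟩
        exact h (dvd_of_mul_right_dvd h1)
      rw [this]; simp
  rw [← hI, bs, hU, Finset.sum_union_inter, Finset.sum_image (fun a _ b _ h => hinj h), bs,
    add_mul, one_mul, Finset.mul_sum]
  simp only [bchi_mul]

lemma bdiv_card (p n : ℕ) (hp : 0 < p) :
    ((((bS (p * n)).filter (fun x => (p : ℤ) ∣ x.1 ∧ (p : ℤ) ∣ x.2)).card : ℕ) : ℤ)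
      = if p ∣ n then br (n / p) else 0 := by
  have hp' : (p : ℤ) ≠ 0 := by positivity
  split_ifs with h
  · obtain ⟨k, rfl⟩ := h
    rw [Nat.mul_div_cancel_left _ hp, br]
    have : (bS (p * (p * k))).filter (fun x => (p : ℤ) ∣ x.1 ∧ (p : ℤ) ∣ x.2)
        = (bS k).image (fun x : ℤ × ℤ => ((p : ℤ) * x.1, (p : ℤ) * x.2)) := by
      ext ⟨c, d⟩
      simp only [Finset.mem_filter, mem_bS, Finset.mem_image, Prod.exists, Prod.mk.injEq]
      constructor
      · rintro ⟨h, ⟨a, rfl⟩, ⟨b, rfl⟩⟩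
        refine ⟨a, b, ?_, rfl, rfl⟩
        simp only [bQ] at h ⊢
        push_cast at h
        apply mul_left_cancel₀ (mul_ne_zero hp' hp')
        linarith
      · rintro ⟨a, b, h, rfl, rfl⟩
        refine ⟨?_, Dvd.intro _ rfl, Dvd.intro _ rfl⟩
        simp only [bQ] at h ⊢
        push_cast
        rw [← h]; ring
    rw [this, Finset.card_image_of_injective]
    rintro ⟨a, b⟩ ⟨c, d⟩ h
    simp only [Prod.mk.injEq, mul_eq_mul_left_iff, hp', or_false] at h
    ext <;> simp [h]
  · rw [Nat.cast_eq_zero, Finset.card_eq_zero, Finset.filter_eq_empty_iff]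
    rintro ⟨c, d⟩ hx ⟨⟨a, ha⟩, ⟨b, hb⟩⟩
    simp only at ha hb
    subst ha hb
    rw [mem_bS] at hx
    simp only [bQ] at hx
    push_cast at hx
    apply h
    rw [← Int.natCast_dvd_natCast]
    refine ⟨bQ (a, b), mul_left_cancel₀ hp' ?_⟩
    simp only [bQ]; linarith

/-- divisibility by an element of prime norm -/
lemma bdvd (p n : ℕ) (hp : p.Prime) (w x : ℤ × ℤ) (hw : bQ w = p) (hx : bQ x = (p : ℤ) * n)
    (h : (p : ℤ) ∣ x.2 * w.1 - x.1 * w.2) : ∃ y, bQ y = n ∧ bm w y = x := by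
  have hp' : (p : ℤ) ≠ 0 := by exact_mod_cast hp.ne_zero
  have hpp : Prime (p : ℤ) := Nat.prime_iff_prime_int.1 hp
  obtain ⟨a, b⟩ := w
  obtain ⟨c, d⟩ := x
  simp only [bQ] at hw hx h ⊢
  obtain ⟨v, hv⟩ := h
  have hu : (p : ℤ) ∣ c * a + c * b + d * b := by
    apply hpp.dvd_of_dvd_pow (n := 2)
    refine ⟨p * n - (c * a + c * b + d * b) * v - p * v ^ 2, ?_⟩
    have e : (c * a + c * b + d * b) ^ 2 + (c * a + c * b + d * b) * (d * a - c * b) +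
      (d * a - c * b) ^ 2 = (a ^ 2 + a * b + b ^ 2) * (c ^ 2 + c * d + d ^ 2) := by ring
    rw [hw, hx, hv] at e
    linear_combination e
  obtain ⟨u, hu⟩ := hu
  have key : bm (a, b) (u, v) = (c, d) := by
    simp only [bm, Prod.mk.injEq]
    constructor <;> apply mul_left_cancel₀ hp'
    · linear_combination -a * hu + b * hv + c * hw
    · linear_combination (-b) * hu - (a + b) * hv + d * hw
  refine ⟨(u, v), ?_, key⟩
  have := bQ_bm (a, b) (u, v)
  rw [key] at this
  simp only [bQ] at this
  rw [hw, hx] at this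
  exact (mul_left_cancel₀ hp' this).symm

lemma bm_inj (w : ℤ × ℤ) (hw : bQ w ≠ 0) : Function.Injective (bm w) := by
  obtain ⟨a, b⟩ := w
  rintro ⟨c, d⟩ ⟨e, f⟩ h
  simp only [bm, bQ, Prod.mk.injEq] at h hw ⊢
  obtain ⟨h1, h2⟩ := h
  constructor <;> apply mul_left_cancel₀ hw
  · linear_combination (a + b) * h1 + b * h2
  · linear_combination a * h2 - b * h1

lemma br_three (n : ℕ) : br (3 * n) = br n := by
  have : bS (3 * n) = (bS n).image (bm (1, 1)) := by
    ext x
    simp only [Finset.mem_image, mem_bS]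
    constructor
    · intro h
      apply bdvd 3 n Nat.prime_three (1, 1) x (by norm_num [bQ]) (by push_cast at h ⊢; exact h)
      simp only [mul_one]
      apply Int.prime_three.dvd_of_dvd_pow (n := 2)
      simp only [bQ] at h
      push_cast at h
      refine ⟨n - x.1 * x.2, ?_⟩
      linear_combination h
    · rintro ⟨y, hy, rfl⟩
      rw [bQ_bm, hy]; norm_num [bQ]
  rw [br, br, this, Finset.card_image_of_injective _ (bm_inj _ (by norm_num [bQ]))]

lemma br_inert (p n : ℕ) (hp : p.Prime) (h2 : p % 3 = 2) :
    br (p * n) = if p ∣ n then br (n / p) else 0 := by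
  rw [← bdiv_card p n hp.pos, Finset.filter_true_of_mem, br]
  rintro ⟨a, b⟩ h
  rw [mem_bS] at h
  have := Fact.mk hp
  simp only [bQ] at h ⊢
  have hz : (a : ZMod p) ^ 2 + a * b + (b : ZMod p) ^ 2 = 0 := by
    have := congrArg (Int.cast : ℤ → ZMod p) h
    push_cast at this
    simpa using this
  simp only [← ZMod.intCast_zmod_eq_zero_iff_dvd] 
  have hb : (b : ZMod p) = 0 := by
    by_contra hb
    set t : ZMod p := a / b with ht
    have h1 : t ^ 2 + t + 1 = 0 := by
      rw [ht]; field_simp; linear_combination hz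
    have h3 : t ^ 3 = 1 := by linear_combination (t - 1) * h1
    have h0 : t ≠ 0 := by rintro h0; rw [h0] at h1; simp at h1
    have h4 := ZMod.pow_card_sub_one_eq_one h0
    have h5 : p - 1 = 3 * (p / 3) + 1 := by omega
    rw [h5, pow_succ, pow_mul, h3, one_pow, one_mul] at h4
    rw [h4] at h1
    have h6 : ((3 : ℕ) : ZMod p) = 0 := by push_cast; linear_combination h1
    rw [ZMod.natCast_eq_zero_iff] at h6
    have := (Nat.prime_dvd_prime_iff_eq hp Nat.prime_three).1 h6
    omega
  rw [hb] at hz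
  simp at hz
  exact ⟨hz, hb⟩

lemma bexists (p : ℕ) (hp : p.Prime) (h1 : p % 3 = 1) : ∃ w, bQ w = p := by
  have := Fact.mk hp
  have hp5 : 2 < p := by have := hp.two_le; omega
  obtain ⟨t, ht⟩ : ∃ t : ZMod p, t ^ 2 + t + 1 = 0 := by
    have := Fact.mk Nat.prime_three
    obtain ⟨g, hg⟩ := exists_prime_orderOf_dvd_card (G := (ZMod p)ˣ) 3 (by
      rw [ZMod.card_units_eq_totient, Nat.totient_prime hp]; omega)
    have h3 : (g : ZMod p) ^ 3 = 1 := by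
      have := pow_orderOf_eq_one g
      rw [hg] at this
      have h' := congrArg Units.val this
      rwa [Units.val_pow_eq_pow_val, Units.val_one] at h'
    have hne : (g : ZMod p) - 1 ≠ 0 := by
      intro h
      have : g = 1 := Units.ext (by simpa [sub_eq_zero] using h)
      rw [this] at hg; simp at hg
    refine ⟨g, mul_left_cancel₀ hne ?_⟩
    linear_combination h3
  set s := Nat.sqrt p with hs
  have hs1 : s * s ≤ p := Nat.sqrt_le p
  have hs2 : p < (s + 1) * (s + 1) := Nat.lt_succ_sqrt p
  have hs3 : s * s ≠ p := by
    intro h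
    have h' := hp
    rw [← h, Nat.prime_mul_iff] at h'
    have h1 : s = 1 := by rcases h' with h' | h' <;> exact h'.2
    rw [h1] at h
    omega
  obtain ⟨x, hx, y, hy, hxy, hf⟩ := Finset.exists_ne_map_eq_of_card_lt_of_maps_to
    (s := Finset.range (s + 1) ×ˢ Finset.range (s + 1)) (t := (Finset.univ : Finset (ZMod p)))
    (f := fun x => (x.1 : ZMod p) - t * x.2) (by simpa [ZMod.card] using hs2) (by simp [Set.MapsTo])
  obtain ⟨a, b⟩ := x
  obtain ⟨c, d⟩ := y
  simp only [Finset.mem_product, Finset.mem_range] at hx hy hf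
  set X : ℤ := (a : ℤ) - c with hX
  set Y : ℤ := (b : ℤ) - d with hY
  have hdv : (p : ℤ) ∣ X ^ 2 + X * Y + Y ^ 2 := by
    rw [← ZMod.intCast_zmod_eq_zero_iff_dvd]
    have hXY : (X : ZMod p) = t * Y := by
      rw [hX, hY]; push_cast; linear_combination hf
    push_cast
    rw [hXY]; linear_combination (Y : ZMod p) ^ 2 * ht
  have hXs : X ^ 2 ≤ s * s := by
    have : |X| ≤ s := by rw [abs_le]; omega
    nlinarith [abs_nonneg X, sq_abs X]
  have hYs : Y ^ 2 ≤ s * s := by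
    have : |Y| ≤ s := by rw [abs_le]; omega
    nlinarith [abs_nonneg Y, sq_abs Y]
  have hsp : (s * s : ℤ) < p := by exact_mod_cast lt_of_le_of_ne hs1 hs3
  have hpos : 0 < X ^ 2 + X * Y + Y ^ 2 := by
    by_contra hc
    have hY0 : Y ^ 2 = 0 := by nlinarith [sq_nonneg (2 * X + Y), sq_nonneg Y]
    have hX0 : X ^ 2 = 0 := by nlinarith [sq_nonneg (2 * Y + X), sq_nonneg X]
    simp only [ne_eq, OfNat.ofNat_ne_zero, not_false_eq_true, pow_eq_zero_iff] at hX0 hY0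
    apply hxy
    ext <;> simp <;> omega
  obtain ⟨k, hk⟩ := hdv
  have hp0 : (0 : ℤ) < p := by exact_mod_cast hp.pos
  have hk0 : 0 < k := by
    by_contra h; push Not at h; nlinarith
  have hk3 : k < 3 := by
    by_contra h; push Not at h; nlinarith [sq_nonneg (X - Y)]
  interval_cases k
  · exact ⟨(X, Y), by simp only [bQ]; linarith⟩
  · exfalso
    have hodd : (p : ℤ) % 2 = 1 := by
      have := hp.eq_two_or_odd; omega
    obtain ⟨m, hm⟩ : ∃ m : ℤ, (p : ℤ) = 2 * m + 1 := ⟨p / 2, by omega⟩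
    rcases Int.even_or_odd' X with ⟨u, hu | hu⟩ <;> rcases Int.even_or_odd' Y with ⟨v, hv | hv⟩ <;>
      rw [hu, hv, hm] at hk <;> ring_nf at hk <;> omega

lemma br_split (p n : ℕ) (hp : p.Prime) (h1 : p % 3 = 1) :
    br (p * n) + (if p ∣ n then br (n / p) else 0) = 2 * br n := by
  obtain ⟨⟨a, b⟩, hw⟩ := bexists p hp h1
  have hpp : Prime (p : ℤ) := Nat.prime_iff_prime_int.1 hp
  have hp2 : p ≠ 2 := by rintro rfl; simp at h1
  have hp3 : p ≠ 3 := by rintro rfl; simp at h1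
  have hp0 : (p : ℤ) ≠ 0 := hpp.ne_zero
  have hw' : bQ (a + b, -b) = p := by rw [← hw]; simp only [bQ]; ring
  have hU : bS (p * n) = (bS n).image (bm (a, b)) ∪ (bS n).image (bm (a + b, -b)) := by
    ext x
    simp only [Finset.mem_union, Finset.mem_image, mem_bS]
    constructor
    · intro h
      push_cast at h
      have hd : (p : ℤ) ∣ (x.2 * a - x.1 * b) * (x.2 * (a + b) - x.1 * (-b)) := by
        refine ⟨x.2 ^ 2 - b ^ 2 * n, ?_⟩
        simp only [bQ] at h hw
        linear_combination x.2 ^ 2 * hw - b ^ 2 * h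
      rcases hpp.dvd_or_dvd hd with hd | hd
      · exact Or.inl (bdvd p n hp _ x hw h hd)
      · exact Or.inr (bdvd p n hp _ x hw' h hd)
    · rintro (⟨y, hy, rfl⟩ | ⟨y, hy, rfl⟩) <;> rw [bQ_bm, hy] <;> simp [hw, hw']
  have hb : ¬ (p : ℤ) ∣ b := by
    rintro ⟨b', hb⟩
    have ha : (p : ℤ) ∣ a := by
      apply hpp.dvd_of_dvd_pow (n := 2)
      simp only [bQ] at hw
      refine ⟨1 - a * b' - b' * b, ?_⟩
      linear_combination hw - (a + b) * hb
    obtain ⟨a', ha⟩ := ha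
    apply hpp.not_dvd_one
    refine ⟨bQ (a', b'), mul_left_cancel₀ hp0 ?_⟩
    rw [mul_one]
    nth_rw 1 [← hw]
    rw [ha, hb]; simp only [bQ]; ring
  have h2 : ¬ (p : ℤ) ∣ 2 := by
    intro h
    exact hp2 ((Nat.prime_dvd_prime_iff_eq hp Nat.prime_two).1 (by exact_mod_cast h))
  have h3 : ¬ (p : ℤ) ∣ 3 := by
    intro h
    exact hp3 ((Nat.prime_dvd_prime_iff_eq hp Nat.prime_three).1 (by exact_mod_cast h))
  have hab : ¬ (p : ℤ) ∣ 2 * a + b := by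
    rintro ⟨k, hk⟩
    have : (p : ℤ) ∣ 3 * b ^ 2 := by
      refine ⟨4 - k * (2 * a + b), ?_⟩
      simp only [bQ] at hw
      linear_combination 4 * hw - (2 * a + b) * hk
    rcases hpp.dvd_or_dvd this with h | h
    · exact h3 h
    · exact hb (hpp.dvd_of_dvd_pow h)
  have hI : (bS n).image (bm (a, b)) ∩ (bS n).image (bm (a + b, -b))
      = (bS (p * n)).filter (fun x => (p : ℤ) ∣ x.1 ∧ (p : ℤ) ∣ x.2) := by
    ext x
    simp only [Finset.mem_inter, Finset.mem_filter, Finset.mem_image, mem_bS]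
    constructor
    · rintro ⟨⟨y, hy, rfl⟩, ⟨z, hz, hzx⟩⟩
      refine ⟨by rw [bQ_bm, hy, hw]; simp, ?_⟩
      set x := bm (a, b) y with hx
      have e1 : (p : ℤ) ∣ x.2 * a - x.1 * b := by
        refine ⟨y.2, ?_⟩
        rw [hx, ← hw]; simp only [bm, bQ]; ring
      have e2 : (p : ℤ) ∣ x.2 * (a + b) - x.1 * (-b) := by
        refine ⟨z.2, ?_⟩
        rw [← hzx, ← hw]; simp only [bm, bQ]; ring
      have e3 : (p : ℤ) ∣ x.2 := by
        have : (p : ℤ) ∣ (2 * a + b) * x.2 := by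
          obtain ⟨k1, e1⟩ := e1
          obtain ⟨k2, e2⟩ := e2
          exact ⟨k1 + k2, by linear_combination e1 + e2⟩
        exact (hpp.dvd_or_dvd this).resolve_left hab
      refine ⟨?_, e3⟩
      have : (p : ℤ) ∣ b * x.1 := by
        obtain ⟨k1, e1⟩ := e1
        obtain ⟨k3, e3⟩ := e3
        exact ⟨k3 * a - k1, by linear_combination a * e3 - e1⟩
      exact (hpp.dvd_or_dvd this).resolve_left hb
    · rintro ⟨h, h1, h2⟩
      push_cast at h
      exact ⟨bdvd p n hp _ x hw h (dvd_sub (h2.mul_right _) (h1.mul_right _)),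
        bdvd p n hp _ x hw' h (dvd_sub (h2.mul_right _) (h1.mul_right _))⟩
  rw [← bdiv_card p n hp.pos, ← hI, br, hU]
  have := Finset.card_union_add_card_inter ((bS n).image (bm (a, b))) ((bS n).image (bm (a + b, -b)))
  rw [Finset.card_image_of_injective _ (bm_inj _ (by rw [hw]; exact hp0)),
    Finset.card_image_of_injective _ (bm_inj _ (by rw [hw']; exact hp0))] at this
  rw [br, two_mul]
  exact_mod_cast this

lemma br_hecke (p n : ℕ) (hp : p.Prime) :
    br (p * n) + bchi p * (if p ∣ n then br (n / p) else 0) = (1 + bchi p) * br n := by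
  have h3 : p % 3 < 3 := Nat.mod_lt _ (by norm_num)
  have hc : p % 3 = 0 ∨ p % 3 = 1 ∨ p % 3 = 2 := by omega
  rcases hc with h | h | h
  · have : p = 3 := ((Nat.prime_dvd_prime_iff_eq Nat.prime_three hp).1 (Nat.dvd_of_mod_eq_zero h)).symm
    subst this
    simp [bchi, br_three]
  · have := br_split p n hp h
    simp only [bchi, h]
    simpa using this
  · have := br_inert p n hp h
    rw [this]
    simp only [bchi, h]
    split_ifs <;> simp_all

theorem br_eq (n : ℕ) (hn : 0 < n) : br n = 6 * bs n := by
  induction n using Nat.strong_induction_on with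
  | _ n ih =>
    by_cases h1 : n = 1
    · subst h1; rw [br_one]; simp [bs, bchi]
    · have hp := Nat.minFac_prime h1
      obtain ⟨k, hk⟩ := Nat.minFac_dvd n
      set p := n.minFac
      have hk0 : 0 < k := by rcases Nat.eq_zero_or_pos k with h | h; · simp [h] at hk; omega
                             · exact h
      have hkn : k < n := by rw [hk]; nlinarith [hp.two_le]
      have e1 := br_hecke p k hp
      have e2 := bs_hecke p k hp hk0
      rw [← hk] at e1 e2
      rw [ih k hkn hk0] at e1
      split_ifs at e1 e2 with hd
      · have hlt : k / p < n := lt_of_le_of_lt (Nat.div_le_self _ _) hkn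
        rw [ih (k / p) hlt (Nat.div_pos (Nat.le_of_dvd hk0 hd) hp.pos)] at e1
        linear_combination e1 - 6 * e2
      · linear_combination e1 - 6 * e2

lemma bQ_nonneg (x : ℤ × ℤ) : 0 ≤ bQ x := by
  simp only [bQ]; nlinarith [sq_nonneg (x.1 + x.2), sq_nonneg x.1, sq_nonneg x.2]

lemma bsummable (q : ℂ) (hq : ‖q‖ < 1) :
    Summable (fun x : ℤ × ℤ => q ^ (bQ x).toNat) := by
  set ρ := Real.sqrt ‖q‖ with hρ
  have hρ0 : 0 ≤ ρ := Real.sqrt_nonneg _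
  have hρ1 : ρ < 1 := by rw [hρ, Real.sqrt_lt' one_pos]; simpa using hq
  have hρq : ρ ^ 2 = ‖q‖ := Real.sq_sqrt (norm_nonneg _)
  have h1 : Summable (fun n : ℤ => ρ ^ n.natAbs) := by
    apply Summable.of_nat_of_neg <;> simpa using summable_geometric_of_lt_one hρ0 hρ1
  have h2 := h1.mul_of_nonneg h1 (fun n => by positivity) (fun n => by positivity)
  refine Summable.of_norm_bounded h2 ?_
  rintro ⟨a, b⟩
  rw [norm_pow, ← hρq, ← pow_mul, ← pow_add]
  apply pow_le_pow_of_le_one hρ0 hρ1.le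
  zify
  rw [Int.toNat_of_nonneg (bQ_nonneg _)]
  simp only [bQ]
  have ha : |a| ≤ a ^ 2 := by rw [← sq_abs]; exact Int.le_self_sq _
  have hb : |b| ≤ b ^ 2 := by rw [← sq_abs]; exact Int.le_self_sq _
  nlinarith [sq_nonneg (a + b)]

lemma a0_hasSum (q : ℂ) (hq : ‖q‖ < 1) :
    HasSum (fun n : ℕ => (br n : ℂ) * q ^ n) (a0 q) := by
  have h0 : a0 q = ∑' x : ℤ × ℤ, q ^ (bQ x).toNat := by
    unfold a0
    refine tsum_congr fun x => ?_
    rw [← zpow_natCast, Int.toNat_of_nonneg (bQ_nonneg _)]; rfl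
  rw [h0]
  have := (bsummable q hq).hasSum.tsum_fiberwise (fun x => (bQ x).toNat)
  refine Eq.mpr (congrArg (fun f => HasSum f _) ?_) this
  funext n
  have hs : (fun x => (bQ x).toNat) ⁻¹' {n} = (bS n : Set (ℤ × ℤ)) := by
    ext x
    have := bQ_nonneg x
    simp only [Set.mem_preimage, Set.mem_singleton_iff, Finset.mem_coe, mem_bS]
    omega
  rw [hs, Finset.tsum_subtype' (bS n) (fun x => q ^ (bQ x).toNat)]
  rw [Finset.sum_congr rfl (g := fun _ => q ^ n)]
  · simp [br]
  · intro x hx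
    rw [mem_bS] at hx
    simp [hx]

lemma br_zero : br 0 = 1 := by decide

lemma a0_eq (q : ℂ) (hq : ‖q‖ < 1) :
    a0 q = 1 + 6 * ∑' n : ℕ+, (bs n : ℂ) * q ^ (n : ℕ) := by
  have h := a0_hasSum q hq
  rw [← h.tsum_eq, ← tsum_zero_pnat_eq_tsum_nat h.summable, br_zero, ← tsum_mul_left]
  simp only [Int.cast_one, pow_zero, mul_one]
  congr 1
  refine tsum_congr fun n => ?_
  rw [br_eq n n.pos]; push_cast; ring

lemma bchi_norm (n : ℕ) : ‖(bchi n : ℂ)‖ ≤ 1 := by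
  unfold bchi; split_ifs <;> simp

lemma lambert (q : ℂ) (hq : ‖q‖ < 1) :
    ∑' n : ℕ+, (bs n : ℂ) * q ^ (n : ℕ)
      = ∑' n : ℕ+, (bchi n : ℂ) * (q ^ (n : ℕ) / (1 - q ^ (n : ℕ))) := by
  have hF : Summable (fun c : ℕ+ × ℕ+ => (bchi c.1 : ℂ) * q ^ (c.1 * c.2 : ℕ)) := by
    have := (summable_prod_mul_pow 0 hq).norm
    refine Summable.of_norm_bounded this ?_
    intro c
    rw [norm_mul]
    simpa using mul_le_mul_of_nonneg_right (bchi_norm c.1) (norm_nonneg (q ^ (c.1 * c.2 : ℕ)))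
  have e1 : ∑' c : ℕ+ × ℕ+, (bchi c.1 : ℂ) * q ^ (c.1 * c.2 : ℕ)
      = ∑' n : ℕ+, (bs n : ℂ) * q ^ (n : ℕ) := by
    have hF' := sigmaAntidiagonalEquivProd.summable_iff.2 hF
    rw [← sigmaAntidiagonalEquivProd.tsum_eq]
    refine (hF'.tsum_sigma).trans ?_
    refine tsum_congr fun n => ?_
    rw [tsum_fintype, Finset.univ_eq_attach]
    have := (n : ℕ).divisorsAntidiagonal.sum_attach
      fun x : ℕ × ℕ => (bchi x.1 : ℂ) * q ^ (x.1 * x.2)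
    refine Eq.trans this ?_
    rw [Nat.sum_divisorsAntidiagonal (fun x y => (bchi x : ℂ) * q ^ (x * y)), bs]
    push_cast
    rw [Finset.sum_mul]
    refine Finset.sum_congr rfl fun d hd => ?_
    rw [Nat.mul_div_cancel' (Nat.dvd_of_mem_divisors hd)]
  rw [← e1, hF.tsum_prod]
  refine tsum_congr fun d => ?_
  dsimp only
  rw [tsum_mul_left]
  congr 1
  rw [tsum_pnat_eq_tsum_succ (f := fun c => q ^ ((d : ℕ) * c))]
  have hd : ‖q ^ (d : ℕ)‖ < 1 := by
    rw [norm_pow]; exact pow_lt_one₀ (norm_nonneg _) hq d.ne_zero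
  simp only [pow_mul, pow_succ]
  rw [tsum_mul_right, tsum_geometric_of_norm_lt_one hd]
  field_simp

/-- `a₀(q) = 1 + 6 ∑_{n≥0} q^{3n+1}/(1-q^{3n+1}) - 6 ∑_{n≥0} q^{3n+2}/(1-q^{3n+2})`. -/
theorem stmt_2 (q : ℂ) (hq : ‖q‖ < 1) :
    a0 q = 1 + 6 * ∑' n : ℕ, q ^ (3 * n + 1) / (1 - q ^ (3 * n + 1))
             - 6 * ∑' n : ℕ, q ^ (3 * n + 2) / (1 - q ^ (3 * n + 2)) := by
  have hs : Summable (fun n : ℕ => (bchi n : ℂ) * (q ^ n / (1 - q ^ n))) := by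
    have := (summable_norm_pow_mul_geometric_div_one_sub 0 hq).norm
    refine Summable.of_norm_bounded this ?_
    intro c
    rw [norm_mul]
    simpa using mul_le_mul_of_nonneg_right (bchi_norm c) (norm_nonneg (q ^ c / (1 - q ^ c)))
  have h0 := tsum_zero_pnat_eq_tsum_nat hs
  have h3 := Nat.sumByResidueClasses hs 3
  have hz : bchi 0 = 0 := rfl
  rw [hz, Int.cast_zero, zero_mul, zero_add, h3] at h0
  rw [a0_eq q hq, lambert q hq, h0]
  change _ + 6 * (∑ j : Fin 3, ∑' m : ℕ, (bchi (j.val + 3 * m) : ℂ) *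
    (q ^ (j.val + 3 * m) / (1 - q ^ (j.val + 3 * m)))) = _
  have c0 (m : ℕ) : bchi (0 + 3 * m) = 0 := by simp [bchi]
  have c1 (m : ℕ) : bchi (1 + 3 * m) = 1 := by simp [bchi, Nat.add_mul_mod_self_left]
  have c2 (m : ℕ) : bchi (2 + 3 * m) = -1 := by simp [bchi, Nat.add_mul_mod_self_left]
  rw [Fin.sum_univ_three]
  simp only [Fin.val_zero, Fin.val_one, Fin.val_two, c0, c1, c2, Int.cast_zero, zero_mul,
    tsum_zero, Int.cast_one, one_mul, Int.cast_neg, neg_mul, tsum_neg]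
  simp only [add_comm _ (3 * _)]
  ring
end

section
/- For every complex number q with |q| < 1, 28·(b₀(q²)⁶ - c₀(q²)⁶) = 27·N(q⁶) + N(q²), where N(q) = 1 - 504 ∑_{n=1}^∞ n⁵ qⁿ/(1-qⁿ). -/
open Complex

noncomputable def omega : ℂ := Complex.exp (2 * Real.pi * Complex.I / 3)

/-- Borwein theta function `b₀(q) = ∑_{m,n ∈ ℤ} ω^{m-n} q^{m²+mn+n²}`. -/
noncomputable def b0 (q : ℂ) : ℂ :=
  ∑' p : ℤ × ℤ, omega ^ (p.1 - p.2) * q ^ (p.1 ^ 2 + p.1 * p.2 + p.2 ^ 2)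

/-- Borwein theta function
`c₀(q) = ∑_{m,n ∈ ℤ} q^{(m+1/3)²+(m+1/3)(n+1/3)+(n+1/3)²}` (principal powers). -/
noncomputable def c0 (q : ℂ) : ℂ :=
  ∑' p : ℤ × ℤ, q ^ ((((p.1 : ℂ) + 1 / 3) ^ 2 + ((p.1 : ℂ) + 1 / 3) * ((p.2 : ℂ) + 1 / 3)
      + ((p.2 : ℂ) + 1 / 3) ^ 2 : ℂ))

/-- Eisenstein series `N(q) = 1 - 504 ∑_{n≥1} n⁵ qⁿ/(1-qⁿ)`. -/
noncomputable def Nq (q : ℂ) : ℂ :=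
  1 - 504 * ∑' n : ℕ, ((n : ℂ) + 1) ^ 5 * q ^ (n + 1) / (1 - q ^ (n + 1))


noncomputable def ee (τ : ℂ) : ℂ := Complex.exp (2 * Real.pi * Complex.I * τ)
noncomputable def PP (q : ℂ) : ℂ := ∏' n : ℕ, (1 - q ^ (n + 1))
noncomputable def DD (q : ℂ) : ℂ := q * PP q ^ 24

open UpperHalfPlane ModularForm in
lemma Nq_eq (z : ℍ) : Nq (ee z) = (E (by norm_num : 3 ≤ 6)) z := by
  rw [EisensteinSeries.q_expansion_bernoulli (by norm_num) (by decide)]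
  have hb : bernoulli 6 = 1 / 42 := by
    rw [bernoulli_eq_bernoulli'_of_ne_one (by norm_num)]
    have h5 : bernoulli' 5 = 0 := by
      have : Nat.choose 5 2 = 10 := by decide
      have h4 : Nat.choose 5 4 = 5 := by decide
      rw [bernoulli'_def]
      norm_num [Finset.sum_range_succ, this, h4]
    have : Nat.choose 6 2 = 15 := by decide
    have h4 : Nat.choose 6 4 = 15 := by decide
    rw [bernoulli'_def]
    norm_num [Finset.sum_range_succ, this, h4, h5]
  have h := tsum_pow_div_one_sub_eq_tsum_sigma (norm_exp_two_pi_I_lt_one z) 5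
  rw [tsum_pnat_eq_tsum_succ (f := fun n ↦
        (n:ℂ)^5 * cexp (2 * Real.pi * Complex.I * z) ^ n / (1 - cexp (2 * Real.pi * Complex.I * z) ^ n))] at h
  rw [hb]
  simp only [zpow_natCast]
  rw [← h, Nq, ee]
  push_cast
  norm_num

lemma im_S {τ : ℂ} (h : 0 < τ.im) : 0 < (-1 / τ).im := by
  rw [neg_div, one_div, ← inv_neg]
  exact UpperHalfPlane.im_inv_neg_coe_pos ⟨τ, h⟩

open UpperHalfPlane ModularForm in
lemma Nq_S {τ : ℂ} (h : 0 < τ.im) : Nq (ee (-1 / τ)) = τ ^ 6 * Nq (ee τ) := by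
  have h1 := Nq_eq ⟨τ, h⟩
  have h2 := Nq_eq (ModularGroup.S • ⟨τ, h⟩)
  have h3 := SlashInvariantForm.slash_action_eqn'' (E (by norm_num : 3 ≤ 6)) (γ := Matrix.SpecialLinearGroup.mapGL ℝ ModularGroup.S) (MonoidHom.mem_range.mpr ⟨_, rfl⟩) ⟨τ, h⟩
  rw [← MulAction.compHom_smul_def] at h3
  rw [← h2, UpperHalfPlane.modular_S_smul] at h3
  have e : (-1 / τ) = (-τ)⁻¹ := by rw [neg_div, one_div, inv_neg]
  rw [e]
  simp only at h3 h1
  rw [← h1] at h3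
  rw [h3]
  have hd : denom ((Matrix.SpecialLinearGroup.mapGL ℝ) ModularGroup.S) τ = τ :=
    ModularGroup.denom_S ⟨τ, h⟩
  rw [hd]
  norm_cast

open UpperHalfPlane ModularForm in
lemma DD_S {τ : ℂ} (h : 0 < τ.im) : DD (ee (-1 / τ)) = τ ^ 12 * DD (ee τ) := by
  have key : ∀ t : ℂ, 0 < t.im → DD (ee t) = ModularForm.eta t ^ 24 := by
    intro t ht
    have h1 : Function.Periodic.qParam 24 t ^ 24 = ee t := by
      rw [Function.Periodic.qParam, ← Complex.exp_nat_mul, ee]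
      congr 1; push_cast; ring
    have h2 : ∏' n, (1 - eta_q n t) = PP (ee t) := by
      simp only [eta_q_eq_pow, PP, ee]
    rw [DD, ModularForm.eta, mul_pow, h1, h2]
  have sq : ∀ z : ℂ, z ≠ 0 → Complex.sqrt z ^ 24 = z ^ 12 := by
    intro z hz
    rw [sqrt_eq_exp hz, ← Complex.exp_nat_mul,
      show ((24 : ℕ) : ℂ) * (Complex.log z / 2) = ((12 : ℕ) : ℂ) * Complex.log z by push_cast; ring,
      Complex.exp_nat_mul, Complex.exp_log hz]
  have h2 := eta_comp_eq_csqrt_I_inv h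
  have h3 : 0 < (-1/τ).im := im_S h
  rw [key _ h, key _ h3]
  simp only [Function.comp, Pi.smul_apply, Pi.mul_apply, smul_eq_mul] at h2
  rw [h2, mul_pow, mul_pow, inv_pow, sq _ Complex.I_ne_zero, sq τ (by rintro rfl; simp at h),
    show Complex.I ^ 12 = (Complex.I ^ 4) ^ 3 by ring, Complex.I_pow_four]
  ring

lemma PP_ne {q : ℂ} (h : ‖q‖ < 1) : PP q ≠ 0 := by
  refine tprod_one_add_ne_zero_of_summable (f := fun n ↦ -q ^ (n+1)) ?_ ?_
  · intro i hi
    have : q ^ (i+1) = 1 := by linear_combination -hi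
    have h2 : ‖q‖ ^ (i+1) < 1 := pow_lt_one₀ (norm_nonneg _) h (by simp)
    rw [← norm_pow, this] at h2
    simp at h2
  · simpa using (summable_nat_add_iff 1).mpr (summable_geometric_of_lt_one (norm_nonneg _) h)

lemma PP_diff : DifferentiableOn ℂ PP (Metric.ball 0 1) := ModularForm.differentiableOn_tprod_one_sub_pow

noncomputable def CC (q : ℂ) : ℂ :=
  ∑' p : ℤ × ℤ, q ^ (p.1 ^ 2 + p.1 * p.2 + p.2 ^ 2 + p.1 + p.2)

lemma c0_pow (q : ℂ) : c0 q ^ 6 = q ^ 2 * CC q ^ 6 := by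
  rcases eq_or_ne q 0 with rfl | hq
  · have : c0 0 = 0 := by
      rw [c0]
      convert tsum_zero with p
      apply Complex.zero_cpow
      intro h
      have h1 : ((9 * (p.1 ^ 2 + p.1 * p.2 + p.2 ^ 2 + p.1 + p.2) + 3 : ℤ) : ℂ) = 0 := by
        push_cast
        linear_combination 9 * h
      have h2 := Int.cast_eq_zero.mp h1
      omega
    simp [this]
  · have : c0 q = q ^ (1 / 3 : ℂ) * CC q := by
      rw [c0, CC, ← tsum_mul_left]
      refine tsum_congr fun p ↦ ?_
      rw [← Complex.cpow_intCast, ← Complex.cpow_add _ _ hq]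
      congr 1
      push_cast
      ring
    rw [this, mul_pow, ← Complex.cpow_nat_mul]
    norm_num

noncomputable def SS (a t : ℂ) : ℂ := ∑' k : ℤ, cexp (Real.pi * I * t * (k + a) ^ 2)

lemma SS_term (a t : ℂ) (k : ℤ) : cexp (Real.pi * I * t * (k + a) ^ 2) =
    cexp (Real.pi * I * a ^ 2 * t) * jacobiTheta₂_term k (a * t) t := by
  rw [jacobiTheta₂_term, ← Complex.exp_add]
  congr 1; ring

lemma SS_summable (a : ℂ) {t : ℂ} (h : 0 < t.im) :
    Summable fun k : ℤ ↦ ‖cexp (Real.pi * I * t * (k + a) ^ 2)‖ := by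
  simp_rw [SS_term]
  exact (((summable_jacobiTheta₂_term_iff (a * t) t).mpr h).mul_left _).norm

lemma SS_eq (a : ℂ) {t : ℂ} (h : 0 < t.im) :
    SS a t = 1 / (-I * t) ^ (1 / 2 : ℂ) * jacobiTheta₂ a (-1 / t) := by
  have ht : t ≠ 0 := by rintro rfl; simp at h
  have : SS a t = cexp (Real.pi * I * a ^ 2 * t) * jacobiTheta₂ (a * t) t := by
    rw [SS, jacobiTheta₂, ← tsum_mul_left]
    exact tsum_congr fun k ↦ SS_term a t k
  rw [this, jacobiTheta₂_functional_equation, mul_div_cancel_right₀ _ ht]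
  have e : cexp (-Real.pi * I * (a * t) ^ 2 / t) = (cexp (Real.pi * I * a ^ 2 * t))⁻¹ := by
    rw [← Complex.exp_neg]
    congr 1
    field_simp
  rw [e]
  field_simp

lemma ee_zpow (τ : ℂ) (n : ℤ) : ee τ ^ n = cexp (2 * Real.pi * I * τ * n) := by
  rw [ee, ← Complex.exp_int_mul]
  congr 1; ring

lemma hasSum_two_ranges {f : ℤ × ℤ → ℂ} {g1 g2 : ℤ × ℤ → ℤ × ℤ} {a b : ℂ}
    (i1 : Function.Injective g1) (i2 : Function.Injective g2)
    (hc : IsCompl (Set.range g1) (Set.range g2)) (s1 : HasSum (f ∘ g1) a)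
    (s2 : HasSum (f ∘ g2) b) : HasSum f (a + b) :=
  HasSum.add_isCompl hc (i1.hasSum_range_iff.mpr s1) (i2.hasSum_range_iff.mpr s2)

lemma CC_eq {τ : ℂ} (h : 0 < τ.im) : cexp (2 * Real.pi * I * τ / 3) * CC (ee τ) =
    SS (1 / 2) (2 * τ) * SS (1 / 6) (6 * τ) + SS 0 (2 * τ) * SS (2 / 3) (6 * τ) := by
  have h2 : 0 < (2 * τ).im := by simpa using h
  have h6 : 0 < (6 * τ).im := by simpa using h
  rw [CC, ← tsum_mul_left]
  set f : ℤ × ℤ → ℂ := fun p ↦ cexp (2 * Real.pi * I * τ / 3) *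
    ee τ ^ (p.1 ^ 2 + p.1 * p.2 + p.2 ^ 2 + p.1 + p.2) with hf
  have key : ∀ (a b : ℂ), HasSum (fun p : ℤ × ℤ ↦ cexp (Real.pi * I * (2 * τ) * (p.1 + a) ^ 2) *
      cexp (Real.pi * I * (6 * τ) * (p.2 + b) ^ 2)) (SS a (2 * τ) * SS b (6 * τ)) := by
    intro a b
    rw [SS, SS, tsum_mul_tsum_of_summable_norm (SS_summable a h2) (SS_summable b h6)]
    exact (summable_mul_of_summable_norm (SS_summable a h2) (SS_summable b h6)).hasSum
  let g1 : ℤ × ℤ → ℤ × ℤ := fun p ↦ (p.1 - p.2, 2 * p.2)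
  let g2 : ℤ × ℤ → ℤ × ℤ := fun p ↦ (p.1 - p.2 - 1, 2 * p.2 + 1)
  have i1 : Function.Injective g1 := by
    rintro ⟨a, b⟩ ⟨c, d⟩ h
    simp only [g1, Prod.mk.injEq] at h ⊢
    omega
  have i2 : Function.Injective g2 := by
    rintro ⟨a, b⟩ ⟨c, d⟩ h
    simp only [g2, Prod.mk.injEq] at h ⊢
    omega
  have s1 : HasSum (f ∘ g1) (SS (1 / 2) (2 * τ) * SS (1 / 6) (6 * τ)) := by
    convert key (1 / 2) (1 / 6) using 2 with p
    simp only [hf, g1, Function.comp, ee_zpow, ← Complex.exp_add]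
    congr 1; push_cast; ring
  have s2 : HasSum (f ∘ g2) (SS 0 (2 * τ) * SS (2 / 3) (6 * τ)) := by
    convert key 0 (2 / 3) using 2 with p
    simp only [hf, g2, Function.comp, ee_zpow, ← Complex.exp_add]
    congr 1; push_cast; ring
  have hc : IsCompl (Set.range g1) (Set.range g2) := by
    constructor
    · rw [Set.disjoint_left]
      rintro _ ⟨⟨a, b⟩, rfl⟩ ⟨⟨c, d⟩, h⟩
      simp only [g1, g2, Prod.mk.injEq] at h
      omega
    · rw [codisjoint_iff_le_sup]
      rintro ⟨m, n⟩ -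
      rcases Int.even_or_odd' n with ⟨k, hk | hk⟩
      · left; exact ⟨(m + k, k), by simp [g1, hk]⟩
      · right; exact ⟨(m + k + 1, k), Prod.ext (by change m + k + 1 - k - 1 = m; omega) (by change 2 * k + 1 = n; omega)⟩
  exact (hasSum_two_ranges i1 i2 hc s1 s2).tsum_eq

lemma omega_zpow (n : ℤ) : omega ^ n = cexp (2 * Real.pi * I * n / 3) := by
  rw [omega, ← Complex.exp_int_mul]
  congr 1; ring

lemma b0_eq {τ : ℂ} (h : 0 < τ.im) :
    jacobiTheta₂ (1 / 2) (3 * τ / 2) * jacobiTheta₂ (1 / 6) (τ / 2) +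
    jacobiTheta₂ 0 (3 * τ / 2) * jacobiTheta₂ (2 / 3) (τ / 2) = 2 * b0 (ee τ) := by
  have h2 : 0 < (3 * τ / 2).im := by
    have : (3 * τ / 2).im = 3 * τ.im / 2 := by simp
    rw [this]; positivity
  have h6 : 0 < (τ / 2).im := by
    have : (τ / 2).im = τ.im / 2 := by simp
    rw [this]; positivity
  have sn : ∀ a t : ℂ, 0 < t.im → Summable fun k : ℤ ↦ ‖jacobiTheta₂_term k a t‖ :=
    fun a t ht ↦ ((summable_jacobiTheta₂_term_iff a t).mpr ht).norm
  simp only [jacobiTheta₂]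
  rw [tsum_mul_tsum_of_summable_norm (sn _ _ h2) (sn _ _ h6),
    tsum_mul_tsum_of_summable_norm (sn _ _ h2) (sn _ _ h6),
    ← (summable_mul_of_summable_norm (sn _ _ h2) (sn _ _ h6)).tsum_add
      (summable_mul_of_summable_norm (sn _ _ h2) (sn _ _ h6)), b0, ← tsum_mul_left]
  let g : ℤ × ℤ → ℤ × ℤ := fun p ↦ (p.2, 2 * p.1 + p.2)
  have ig : Function.Injective g := by
    rintro ⟨a, b⟩ ⟨c, d⟩ h
    simp only [g, Prod.mk.injEq] at h ⊢
    omega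
  have term : ∀ k l : ℤ, jacobiTheta₂_term k (1 / 2) (3 * τ / 2) * jacobiTheta₂_term l (1 / 6) (τ / 2) +
      jacobiTheta₂_term k 0 (3 * τ / 2) * jacobiTheta₂_term l (2 / 3) (τ / 2) =
      ((-1) ^ (k + l) + 1) * cexp (2 * Real.pi * I * l * (2 / 3) +
        Real.pi * I * τ * ((3 * k ^ 2 + l ^ 2) / 2)) := by
    intro k l
    have e1 : ((-1 : ℂ)) ^ (k + l) = cexp (Real.pi * I * (k + l) - 2 * Real.pi * I * l) := by
      rw [Complex.exp_sub, show 2 * Real.pi * I * l = l * (2 * Real.pi * I) by ring,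
        Complex.exp_int_mul_two_pi_mul_I, div_one, ← Complex.exp_pi_mul_I, ← Complex.exp_int_mul]
      congr 1; push_cast; ring
    rw [e1, add_mul, one_mul]
    simp only [jacobiTheta₂_term, ← Complex.exp_add]
    congr 2 <;> ring
  have hsupp : Function.support (fun p : ℤ × ℤ ↦
      jacobiTheta₂_term p.1 (1 / 2) (3 * τ / 2) * jacobiTheta₂_term p.2 (1 / 6) (τ / 2) +
      jacobiTheta₂_term p.1 0 (3 * τ / 2) * jacobiTheta₂_term p.2 (2 / 3) (τ / 2)) ⊆ Set.range g := by
    rintro ⟨k, l⟩ hp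
    rw [Function.mem_support, term] at hp
    rcases Int.even_or_odd (k + l) with he | ho
    · obtain ⟨r, hr⟩ := he
      exact ⟨(r - k, k), Prod.ext rfl (by change 2 * (r - k) + k = l; omega)⟩
    · simp [ho.neg_one_zpow] at hp
  rw [← ig.tsum_eq hsupp]
  refine tsum_congr fun p ↦ ?_
  rw [term]
  have he : Even ((g p).1 + (g p).2) := ⟨p.1 + p.2, by simp only [g]; ring⟩
  rw [he.neg_one_zpow, omega_zpow, ee_zpow, ← Complex.exp_add, one_add_one_eq_two]
  congr 1
  have : (2 * Real.pi * I * (g p).2 * (2 / 3) +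
        Real.pi * I * τ * ((3 * (g p).1 ^ 2 + (g p).2 ^ 2) / 2)) =
      2 * Real.pi * I * ((p.1 - p.2 : ℤ) : ℂ) / 3 + 2 * Real.pi * I * τ *
        ((p.1 ^ 2 + p.1 * p.2 + p.2 ^ 2 : ℤ) : ℂ) + ((p.1 + p.2 : ℤ) : ℂ) * (2 * Real.pi * I) := by
    simp only [g]; push_cast; ring
  rw [this, Complex.exp_add _ (((p.1 + p.2 : ℤ) : ℂ) * (2 * Real.pi * I)),
    Complex.exp_int_mul_two_pi_mul_I, mul_one]

lemma b0_W {τ : ℂ} (h : 0 < τ.im) :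
    b0 (ee (-1 / (3 * τ))) ^ 6 = -27 * τ ^ 6 * (ee τ ^ 2 * CC (ee τ) ^ 6) := by
  have ht : τ ≠ 0 := by rintro rfl; simp at h
  have h2 : 0 < (2 * τ).im := by simpa using h
  have h3 : 0 < (3 * τ).im := by simpa using h
  have h6 : 0 < (6 * τ).im := by simpa using h
  have hb := b0_eq (im_S h3)
  have hc := CC_eq h
  rw [SS_eq _ h2, SS_eq _ h2, SS_eq _ h6, SS_eq _ h6,
    show -1 / (2 * τ) = 3 * (-1 / (3 * τ)) / 2 by field_simp,
    show -1 / (6 * τ) = (-1 / (3 * τ)) / 2 by field_simp; norm_num] at hc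
  have hc2 : cexp (2 * Real.pi * I * τ / 3) * CC (ee τ) =
    1 / (-I * (2 * τ)) ^ (1 / 2 : ℂ) * (1 / (-I * (6 * τ)) ^ (1 / 2 : ℂ)) * (2 * b0 (ee (-1 / (3 * τ)))) := by
    rw [hc, ← hb]; ring
  have hp : ∀ z : ℂ, (z ^ (1 / 2 : ℂ)) ^ 6 = z ^ 3 := by
    intro z
    rw [← Complex.cpow_nat_mul, ← Complex.cpow_natCast z 3]
    norm_num
  have hc3 := congrArg (· ^ 6) hc2
  simp only [mul_pow, div_pow, hp, one_pow] at hc3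
  have he : cexp (2 * Real.pi * I * τ / 3) ^ 6 = ee τ ^ 2 := by
    rw [ee, ← Complex.exp_nat_mul, ← Complex.exp_nat_mul]
    congr 1; push_cast; ring
  rw [he] at hc3
  rw [hc3]
  have hI : I ^ 6 = -1 := by rw [show I ^ 6 = (I ^ 2) ^ 3 by ring, Complex.I_sq]; norm_num
  field_simp
  rw [hI]
  ring

lemma summable_natAbs {ρ : ℝ} (h0 : 0 ≤ ρ) (h1 : ρ < 1) : Summable fun n : ℤ ↦ ρ ^ n.natAbs := by
  apply Summable.of_nat_of_neg <;> simpa using summable_geometric_of_lt_one h0 h1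

lemma diff_gen (w : ℤ × ℤ → ℂ) (hw : ∀ p, ‖w p‖ ≤ 1) (e : ℤ × ℤ → ℕ)
    (he : ∀ p, p.1.natAbs + p.2.natAbs ≤ 2 * e p + 1) :
    DifferentiableOn ℂ (fun q : ℂ ↦ ∑' p, w p * q ^ (e p)) (Metric.ball 0 1) := by
  intro q hq
  have hq1 : ‖q‖ < 1 := by simpa using hq
  obtain ⟨r, hr, hr1⟩ := exists_between hq1
  have hr0 : 0 < r := (norm_nonneg q).trans_lt hr
  set ρ := Real.sqrt r with hρ
  have hρ0 : 0 < ρ := Real.sqrt_pos.mpr hr0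
  have hρ1 : ρ < 1 := by rw [hρ, Real.sqrt_lt' one_pos]; simpa using hr1
  have hρ2 : ρ ^ 2 = r := Real.sq_sqrt hr0.le
  have hs : Summable fun p : ℤ × ℤ ↦ ρ⁻¹ * (ρ ^ p.1.natAbs * ρ ^ p.2.natAbs) := by
    apply Summable.mul_left
    apply Summable.mul_of_nonneg (summable_natAbs hρ0.le hρ1) (summable_natAbs hρ0.le hρ1)
    · intro n; positivity
    · intro n; positivity
  have := Complex.differentiableOn_tsum_of_summable_norm (U := Metric.ball (0 : ℂ) r)
    (F := fun p (q : ℂ) ↦ w p * q ^ (e p)) hs (fun p ↦ by fun_prop) Metric.isOpen_ball (by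
      intro p z hz
      have hz1 : ‖z‖ ≤ r := by simpa using (Metric.mem_ball.mp hz).le
      have hE : ρ ^ (2 * e p + 1) ≤ ρ ^ (p.1.natAbs + p.2.natAbs) :=
        pow_le_pow_of_le_one hρ0.le hρ1.le (he p)
      rw [norm_mul, norm_pow]
      calc ‖w p‖ * ‖z‖ ^ e p ≤ 1 * r ^ e p := by gcongr; exact hw p
        _ = ρ⁻¹ * ρ ^ (2 * e p + 1) := by rw [← hρ2]; field_simp; ring
        _ ≤ ρ⁻¹ * ρ ^ (p.1.natAbs + p.2.natAbs) := by gcongr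
        _ = _ := by rw [pow_add])
  exact (this.differentiableAt (Metric.isOpen_ball.mem_nhds (by simpa using hr))).differentiableWithinAt

lemma natAbs_le_sq (m : ℤ) : (m.natAbs : ℤ) ≤ m ^ 2 := by
  rw [← Int.natAbs_sq]
  exact_mod_cast Nat.le_self_pow two_ne_zero _

lemma norm_omega : ‖omega‖ = 1 := by
  rw [omega, show (2 * Real.pi * I / 3 : ℂ) = ((2 * Real.pi / 3 : ℝ) : ℂ) * I by push_cast; ring]
  exact Complex.norm_exp_ofReal_mul_I _

lemma b0_diff : DifferentiableOn ℂ b0 (Metric.ball 0 1) := by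
  have hn : ∀ p : ℤ × ℤ, (p.1.natAbs : ℤ) + p.2.natAbs ≤ 2 * (p.1 ^ 2 + p.1 * p.2 + p.2 ^ 2) := by
    intro p
    nlinarith [natAbs_le_sq p.1, natAbs_le_sq p.2, sq_nonneg (p.1 + p.2)]
  have := diff_gen (fun p ↦ omega ^ (p.1 - p.2)) (fun p ↦ by simp [norm_omega])
    (fun p ↦ (p.1 ^ 2 + p.1 * p.2 + p.2 ^ 2).toNat) (by
      intro p; have := hn p; omega)
  refine this.congr fun q _ ↦ tsum_congr fun p ↦ ?_
  have := hn p
  rw [← zpow_natCast, Int.toNat_of_nonneg (by omega)]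

lemma CC_diff : DifferentiableOn ℂ CC (Metric.ball 0 1) := by
  have hn : ∀ p : ℤ × ℤ, (p.1.natAbs : ℤ) + p.2.natAbs ≤
      2 * (p.1 ^ 2 + p.1 * p.2 + p.2 ^ 2 + p.1 + p.2) + 1 := by
    intro p
    nlinarith [natAbs_le_sq p.1, natAbs_le_sq p.2, sq_nonneg (p.1 + p.2 + 1)]
  have := diff_gen (fun p ↦ 1) (fun p ↦ by simp)
    (fun p ↦ (p.1 ^ 2 + p.1 * p.2 + p.2 ^ 2 + p.1 + p.2).toNat) (by
      intro p; have := hn p; omega)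
  refine this.congr fun q _ ↦ tsum_congr fun p ↦ ?_
  have := hn p
  rw [← zpow_natCast, Int.toNat_of_nonneg (by omega), one_mul]

lemma Nq_diff : DifferentiableOn ℂ Nq (Metric.ball 0 1) := by
  have : DifferentiableOn ℂ (fun q : ℂ ↦ ∑' n : ℕ, ((n : ℂ) + 1) ^ 5 * q ^ (n + 1) / (1 - q ^ (n + 1)))
      (Metric.ball 0 1) := by
    intro q hq
    have hq1 : ‖q‖ < 1 := by simpa using hq
    obtain ⟨r, hr, hr1⟩ := exists_between hq1
    have hr0 : 0 < r := (norm_nonneg q).trans_lt hr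
    have hle : ∀ z ∈ Metric.ball (0 : ℂ) r, ∀ n : ℕ, 1 - r ≤ ‖1 - z ^ (n + 1)‖ := by
      intro z hz n
      have hz1 : ‖z‖ ≤ r := by simpa using (Metric.mem_ball.mp hz).le
      have h1 : ‖z ^ (n + 1)‖ ≤ r := by
        rw [norm_pow]
        calc ‖z‖ ^ (n + 1) ≤ r ^ (n + 1) := by gcongr
          _ ≤ r ^ 1 := pow_le_pow_of_le_one hr0.le hr1.le (by omega)
          _ = r := pow_one r
      have h2 := norm_sub_norm_le (1 : ℂ) (z ^ (n + 1))
      rw [norm_one] at h2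
      linarith
    have hs : Summable fun n : ℕ ↦ ((n : ℝ) + 1) ^ 5 * r ^ (n + 1) / (1 - r) := by
      apply Summable.div_const
      have := (summable_nat_add_iff 1).mpr
        (summable_pow_mul_geometric_of_norm_lt_one 5 (r := r) (by rwa [Real.norm_of_nonneg hr0.le]))
      simpa using this
    have := Complex.differentiableOn_tsum_of_summable_norm (U := Metric.ball (0 : ℂ) r)
      (F := fun (n : ℕ) (q : ℂ) ↦ ((n : ℂ) + 1) ^ 5 * q ^ (n + 1) / (1 - q ^ (n + 1))) hs (by
        intro n
        apply DifferentiableOn.div (by fun_prop) (by fun_prop)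
        intro z hz h0
        have := hle z hz n
        rw [h0, norm_zero] at this
        linarith) Metric.isOpen_ball (by
        intro n z hz
        have hz1 : ‖z‖ ≤ r := by simpa using (Metric.mem_ball.mp hz).le
        have hh := hle z hz n
        have hn : ‖(n : ℂ) + 1‖ = (n : ℝ) + 1 := by
          have := Complex.norm_natCast (n + 1)
          push_cast at this
          exact this
        rw [norm_div, norm_mul, norm_pow, norm_pow, hn]
        have : 0 < 1 - r := by linarith
        gcongr)
    exact (this.differentiableAt (Metric.isOpen_ball.mem_nhds (by simpa using hr))).differentiableWithinAt
  exact (differentiableOn_const _).sub ((differentiableOn_const _).mul this)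

noncomputable def FF (q : ℂ) : ℂ :=
  28 * (b0 q ^ 6 - q ^ 2 * CC q ^ 6) - (27 * Nq (q ^ 3) + Nq q)

lemma cube_maps : Set.MapsTo (fun q : ℂ ↦ q ^ 3) (Metric.ball 0 1) (Metric.ball 0 1) := by
  intro q hq
  have : ‖q‖ < 1 := by simpa using hq
  simpa using pow_lt_one₀ (norm_nonneg q) this (by norm_num : 3 ≠ 0)

lemma FF_diff : DifferentiableOn ℂ FF (Metric.ball 0 1) := by
  have h3 : DifferentiableOn ℂ (fun q : ℂ ↦ Nq (q ^ 3)) (Metric.ball 0 1) :=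
    Nq_diff.comp (f := fun q : ℂ ↦ q ^ 3) (by fun_prop) cube_maps
  have hb := b0_diff
  have hc := CC_diff
  have hN := Nq_diff
  unfold FF
  fun_prop

lemma FF_zero : FF 0 = 0 := by
  have hb : b0 0 = 1 := by
    rw [b0, tsum_eq_single (0, 0)]
    · simp
    · rintro ⟨m, n⟩ h
      rw [zero_zpow, mul_zero]
      intro h0
      apply h
      have hm : m ^ 2 = 0 := by nlinarith [sq_nonneg m, sq_nonneg n, sq_nonneg (m + n)]
      have hn : n ^ 2 = 0 := by nlinarith [sq_nonneg m, sq_nonneg n, sq_nonneg (m + n)]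
      simp at hm hn
      simp [hm, hn]
  have hN : Nq 0 = 1 := by simp [Nq]
  simp only [FF, hb]
  norm_num [hN]

lemma norm_ee (τ : ℂ) : ‖ee τ‖ = Real.exp (-2 * Real.pi * τ.im) := by
  rw [ee, Complex.norm_exp]
  congr 1
  simp

lemma norm_ee_lt {τ : ℂ} (h : 0 < τ.im) : ‖ee τ‖ < 1 := by
  rw [norm_ee, Real.exp_lt_one_iff]
  have := mul_pos Real.pi_pos h
  linarith

lemma ee_three (τ : ℂ) : ee τ ^ 3 = ee (3 * τ) := by
  rw [ee, ee, ← Complex.exp_nat_mul]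
  congr 1; push_cast; ring

lemma ee_add_int (τ : ℂ) (n : ℤ) : ee (τ + n) = ee τ := by
  rw [ee, ee, show 2 * Real.pi * I * (τ + n) = 2 * Real.pi * I * τ + n * (2 * Real.pi * I) by ring,
    Complex.exp_add, Complex.exp_int_mul_two_pi_mul_I, mul_one]

lemma FF_W {τ : ℂ} (h : 0 < τ.im) : FF (ee (-1 / (3 * τ))) = 27 * τ ^ 6 * FF (ee τ) := by
  have ht : τ ≠ 0 := by rintro rfl; simp at h
  have h3 : 0 < (3 * τ).im := by simpa using h
  have e1 := b0_W h
  have e2 := b0_W (im_S h3)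
  rw [show -1 / (3 * (-1 / (3 * τ))) = τ by field_simp] at e2
  have e2' : ee (-1 / (3 * τ)) ^ 2 * CC (ee (-1 / (3 * τ))) ^ 6 = -27 * τ ^ 6 * b0 (ee τ) ^ 6 := by
    rw [e2]
    generalize ee (-1 / (3 * τ)) ^ 2 * CC (ee (-1 / (3 * τ))) ^ 6 = X
    field_simp
    norm_num
  have e3 := Nq_S h
  have e4 := Nq_S h3
  rw [FF, FF, e1, e2', ee_three, ee_three, show 3 * (-1 / (3 * τ)) = -1 / τ by field_simp, e3, e4]
  ring

lemma DD_W {τ : ℂ} (h : 0 < τ.im) : DD (ee (-1 / (3 * τ))) * DD (ee (-1 / (3 * τ)) ^ 3) =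
    (27 * τ ^ 6) ^ 4 * (DD (ee τ) * DD (ee τ ^ 3)) := by
  have ht : τ ≠ 0 := by rintro rfl; simp at h
  have h3 : 0 < (3 * τ).im := by simpa using h
  rw [ee_three, ee_three, show 3 * (-1 / (3 * τ)) = -1 / τ by field_simp, DD_S h, DD_S h3]
  ring

noncomputable def HH (q : ℂ) : ℂ := dslope FF 0 q ^ 4 / (PP q ^ 24 * PP (q ^ 3) ^ 24)

lemma HH_diff : DifferentiableOn ℂ HH (Metric.ball 0 1) := by
  have h1 : DifferentiableOn ℂ (dslope FF 0) (Metric.ball 0 1) :=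
    (Complex.differentiableOn_dslope (Metric.ball_mem_nhds 0 one_pos)).mpr FF_diff
  have h3 : DifferentiableOn ℂ (fun q : ℂ ↦ PP (q ^ 3)) (Metric.ball 0 1) :=
    PP_diff.comp (f := fun q : ℂ ↦ q ^ 3) (by fun_prop) cube_maps
  have h2 := PP_diff
  apply DifferentiableOn.div (by fun_prop) (by fun_prop)
  intro q hq
  have a := PP_ne (q := q) (by simpa using hq)
  have b := PP_ne (q := q ^ 3) (by simpa using cube_maps hq)
  positivity

lemma HH_eq {q : ℂ} (h0 : q ≠ 0) : HH q = FF q ^ 4 / (DD q * DD (q ^ 3)) := by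
  have : FF q = q * dslope FF 0 q := by
    have := sub_smul_dslope FF 0 q
    rw [FF_zero] at this
    simpa using this.symm
  rw [this, HH, DD, DD]
  field_simp

lemma ee_ne (τ : ℂ) : ee τ ≠ 0 := Complex.exp_ne_zero _

lemma HH_W {τ : ℂ} (h : 0 < τ.im) : HH (ee (-1 / (3 * τ))) = HH (ee τ) := by
  have ht : τ ≠ 0 := by rintro rfl; simp at h
  rw [HH_eq (ee_ne _), HH_eq (ee_ne _), FF_W h, DD_W h, mul_pow, mul_div_mul_left]
  simp [ht]

lemma reduce (n : ℕ) : ∀ τ : ℂ, 0 < τ.im → 1 / 4 ≤ (16 / 15 : ℝ) ^ n * τ.im →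
    ∃ τ' : ℂ, 1 / 4 ≤ τ'.im ∧ HH (ee τ') = HH (ee τ) := by
  induction n with
  | zero => intro τ h h1; exact ⟨τ, by simpa using h1, rfl⟩
  | succ n ih =>
    intro τ h h1
    by_cases h4 : 1 / 4 ≤ τ.im
    · exact ⟨τ, h4, rfl⟩
    push Not at h4
    set σ : ℂ := τ + ((-round τ.re : ℤ) : ℂ) with hσ
    have hre : |σ.re| ≤ 1 / 2 := by
      have := abs_sub_round τ.re
      simpa [hσ, ← sub_eq_add_neg] using this
    have him : σ.im = τ.im := by simp [hσ]
    have hσ0 : 0 < σ.im := him ▸ h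
    have hn : Complex.normSq σ ≤ 5 / 16 := by
      rw [Complex.normSq_apply, him]
      have := abs_le.mp hre
      nlinarith
    have hnp : 0 < Complex.normSq σ := by
      apply Complex.normSq_pos.mpr
      intro h0; rw [h0] at hσ0; simp at hσ0
    have hW : (-1 / (3 * σ)).im = σ.im / (3 * Complex.normSq σ) := by
      rw [show -1 / (3 * σ) = ((-1 / 3 : ℝ) : ℂ) * σ⁻¹ by
        push_cast; rw [div_mul_eq_mul_div, ← div_div]; ring]
      rw [Complex.im_ofReal_mul, Complex.inv_im]
      field_simp
    have hge : 16 / 15 * τ.im ≤ (-1 / (3 * σ)).im := by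
      rw [hW, him, le_div_iff₀ (by positivity)]
      nlinarith
    obtain ⟨τ', h', e'⟩ := ih (-1 / (3 * σ)) (by nlinarith) (by
      have : (0 : ℝ) < (16 / 15 : ℝ) ^ n := by positivity
      calc (1 / 4 : ℝ) ≤ (16 / 15 : ℝ) ^ n * (16 / 15 * τ.im) := by rw [pow_succ] at h1; linarith
        _ ≤ _ := by gcongr)
    exact ⟨τ', h', by rw [e', HH_W hσ0, hσ, ee_add_int]⟩

lemma exists_ee {q : ℂ} (h0 : q ≠ 0) (h1 : ‖q‖ < 1) : ∃ τ : ℂ, 0 < τ.im ∧ ee τ = q := by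
  have e : ee (Complex.log q / (2 * Real.pi * I)) = q := by
    rw [ee, mul_div_cancel₀ _ (by simp [Real.pi_ne_zero]), Complex.exp_log h0]
  refine ⟨_, ?_, e⟩
  by_contra hc
  push Not at hc
  rw [← e, norm_ee, Real.exp_lt_one_iff] at h1
  nlinarith [Real.pi_pos]

lemma HH_const : ∃ c : ℂ, ∀ q ∈ Metric.ball (0 : ℂ) 1, HH q = c := by
  set r : ℝ := Real.exp (-2 * Real.pi * (1 / 4)) with hr
  have hr0 : 0 < r := Real.exp_pos _
  have hr1 : r < 1 := by
    rw [hr, Real.exp_lt_one_iff]; linarith [Real.pi_pos]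
  have hsub : Metric.closedBall (0 : ℂ) r ⊆ Metric.ball 0 1 := Metric.closedBall_subset_ball hr1
  obtain ⟨c, hc, hmax⟩ := (isCompact_closedBall (0 : ℂ) r).exists_isMaxOn
    ⟨0, by simp [hr0.le]⟩ (HH_diff.continuousOn.mono hsub).norm
  refine ⟨HH c, fun q hq ↦ ?_⟩
  refine Complex.eqOn_of_isPreconnected_of_isMaxOn_norm (convex_ball (0 : ℂ) 1).isPreconnected
    Metric.isOpen_ball HH_diff (hsub hc) ?_ hq
  intro z hz
  rcases eq_or_ne z 0 with rfl | hz0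
  · exact hmax (by simp [hr0.le])
  obtain ⟨τ, hτ, rfl⟩ := exists_ee hz0 (by simpa using hz)
  obtain ⟨n, hn⟩ := pow_unbounded_of_one_lt (1 / 4 / τ.im) (by norm_num : (1 : ℝ) < 16 / 15)
  obtain ⟨τ', h', e'⟩ := reduce n τ hτ (by rw [div_lt_iff₀ hτ] at hn; exact hn.le)
  have : ‖HH (ee τ')‖ ≤ ‖HH c‖ := hmax (by
    rw [mem_closedBall_zero_iff, norm_ee, hr, Real.exp_le_exp]
    nlinarith [Real.pi_pos])
  rw [e'] at this
  exact this

lemma FF_eq_zero {q : ℂ} (h : ‖q‖ < 1) : FF q = 0 := by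
  rcases eq_or_ne q 0 with rfl | h0
  · exact FF_zero
  obtain ⟨c, hc⟩ := HH_const
  have hs : ((Real.sqrt 3 : ℝ) : ℂ) ^ 2 = 3 := by
    rw [← Complex.ofReal_pow, Real.sq_sqrt (by norm_num)]; norm_num
  have hs0 : ((Real.sqrt 3 : ℝ) : ℂ) ≠ 0 := by
    intro h; rw [h] at hs; norm_num at hs
  set τ : ℂ := ((Real.sqrt 3 / 3 : ℝ) : ℂ) * I with hτ
  have him : 0 < τ.im := by
    have : τ.im = Real.sqrt 3 / 3 := by simp [hτ]
    rw [this]; positivity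
  have ht : τ ≠ 0 := by intro h; rw [h] at him; simp at him
  have hsq : τ ^ 2 = -1 / 3 := by
    rw [hτ, mul_pow, Complex.I_sq]; push_cast; rw [div_pow, hs]; norm_num
  have hfix : -1 / (3 * τ) = τ := by
    rw [div_eq_iff (by simpa using ht)]; linear_combination -3 * hsq
  have hF := FF_W him
  rw [hfix, show τ ^ 6 = (τ ^ 2) ^ 3 by ring, hsq] at hF
  have hF0 : FF (ee τ) = 0 := by
    linear_combination (1 / 2) * hF
  have hc0 : c = 0 := by
    rw [← hc (ee τ) (by simpa using norm_ee_lt him), HH_eq (ee_ne _), hF0]; simp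
  have hq := hc q (by simpa using h)
  rw [hc0, HH_eq h0, div_eq_zero_iff] at hq
  have a := PP_ne h
  have b := PP_ne (q := q ^ 3) (by simpa using cube_maps (by simpa using h : q ∈ Metric.ball (0 : ℂ) 1))
  rcases hq with hq | hq
  · exact pow_eq_zero_iff (by norm_num) |>.mp hq
  · simp [DD, h0, a, b] at hq


/-- `28(b₀(q²)⁶ - c₀(q²)⁶) = 27 N(q⁶) + N(q²)` for `|q| < 1`. -/
theorem stmt_7 (q : ℂ) (hq : ‖q‖ < 1) :
    28 * (b0 (q ^ 2) ^ 6 - c0 (q ^ 2) ^ 6) = 27 * Nq (q ^ 6) + Nq (q ^ 2) := by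
  have hQ : ‖q ^ 2‖ < 1 := by
    rw [norm_pow]; exact pow_lt_one₀ (norm_nonneg q) hq (by norm_num)
  have h := FF_eq_zero hQ
  rw [FF, ← pow_mul q 2 3] at h
  rw [c0_pow]
  linear_combination h
end
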